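/- Fix positive integers k and d. Every graph G with tw(G) ≤ k − 1 and Δ(G) ≤ d has a tree-partition (B_x : x ∈ V(T)) of width at most 18kd over a tree T with Δ(T) ≤ 6d. -/

import Mathlib

open SimpleGraph

/-- The maximum degree of a finite simple graph `G`:
the supremum of the numbers of neighbours of its vertices. -/
noncomputable def maxDeg {V : Type*} [Fintype V] (G : SimpleGraph V) : ℕ :=
  sSup (Set.range fun v => (G.neighborSet v).ncard)

/-- `B` is a `T`-partition of the graph `G`: the tree `T` indexes a partition
`(B x : x ∈ V(T))` of `V(G)` such that for every edge `vw` of `G`, if `v ∈ B x` and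
`w ∈ B y` then `x = y` or `xy ∈ E(T)`. -/
structure IsTreePartition {V ι : Type*} (G : SimpleGraph V) (T : SimpleGraph ι)
    (B : ι → Set V) : Prop where
  /-- `T` is a tree. -/
  isTree : T.IsTree
  /-- the parts are nonempty -/
  part_nonempty : ∀ x, (B x).Nonempty
  /-- every vertex of `G` lies in exactly one part -/
  part_existsUnique : ∀ v, ∃! x, v ∈ B x
  /-- parts containing adjacent vertices are equal or adjacent in `T` -/
  part_adj : ∀ ⦃v w x y⦄, G.Adj v w → v ∈ B x → w ∈ B y → x = y ∨ T.Adj x y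

/-- `B` is a tree-decomposition of the graph `G` over the tree `T`:
every edge of `G` has both ends in a common bag, and for each vertex `v` of `G`
the set of nodes whose bag contains `v` induces a non-empty subtree of `T`. -/
structure IsTreeDecomp {V ι : Type*} (G : SimpleGraph V) (T : SimpleGraph ι)
    (B : ι → Set V) : Prop where
  /-- `T` is a tree. -/
  isTree : T.IsTree
  /-- every edge of `G` lies in some bag -/
  edge_mem : ∀ ⦃u v⦄, G.Adj u v → ∃ x, u ∈ B x ∧ v ∈ B x
  /-- the bags containing a given vertex induce a non-empty subtree -/
  subtree : ∀ v, (T.induce {x | v ∈ B x}).Connected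

/-- The treewidth of a finite graph: the minimum, over tree-decompositions,
of the maximum bag size minus one. -/
noncomputable def treewidth {V : Type} [Fintype V] (G : SimpleGraph V) : ℕ :=
  sInf {k | ∃ (ι : Type) (_ : Fintype ι) (T : SimpleGraph ι) (B : ι → Set V),
    IsTreeDecomp G T B ∧ ∀ x, (B x).ncard ≤ k + 1}

/-- The tree-partition-width of a finite graph: the minimum width of a tree-partition. -/
noncomputable def tpw {V : Type} [Fintype V] (G : SimpleGraph V) : ℕ :=
  sInf {k | ∃ (ι : Type) (_ : Fintype ι) (T : SimpleGraph ι) (B : ι → Set V),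
    IsTreePartition G T B ∧ ∀ x, (B x).ncard ≤ k}

lemma isTree_fromRel_parent {ι : Type*} [Finite ι] (root : ι) (p : ι → ι) (h : ι → ℕ)
    (hp : ∀ x, x ≠ root → h (p x) < h x) (hr : p root = root) :
    (SimpleGraph.fromRel fun x y => p x = y).IsTree := by
  classical
  have := Fintype.ofFinite ι
  set T := SimpleGraph.fromRel fun x y => p x = y with hT
  have hreach : ∀ n, ∀ x, h x = n → T.Reachable x root := by
    intro n
    induction n using Nat.strong_induction_on with
    | _ n ih =>
      intro x hx
      by_cases hxr : x = root
      · rw [hxr]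
      have hlt := hp x hxr
      have hadj : T.Adj x (p x) := by
        rw [hT, SimpleGraph.fromRel_adj]
        refine ⟨?_, Or.inl rfl⟩
        intro he
        rw [← he] at hlt
        exact lt_irrefl _ hlt
      exact hadj.reachable.trans (ih _ (hx ▸ hlt) _ rfl)
  have hconn : T.Connected := by
    have : Nonempty ι := ⟨root⟩
    exact ⟨fun x y => (hreach _ x rfl).trans (hreach _ y rfl).symm⟩
  rw [SimpleGraph.isTree_iff_connected_and_card]
  refine ⟨hconn, le_antisymm ?_ hconn.card_vert_le_card_edgeSet_add_one⟩
  have hsub : T.edgeSet ⊆ (fun x => s(x, p x)) '' {x | x ≠ root} := by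
    intro e
    induction e using Sym2.ind with
    | _ x y =>
      rw [SimpleGraph.mem_edgeSet, hT, SimpleGraph.fromRel_adj]
      rintro ⟨hne, hxy | hxy⟩
      · refine ⟨x, ?_, by simp [hxy]⟩
        rintro rfl
        exact hne (hr.symm.trans hxy)
      · refine ⟨y, ?_, by simp [hxy, Sym2.eq_swap]⟩
        rintro rfl
        exact hne (hxy.symm.trans hr)
  have h1 : T.edgeSet.ncard ≤ ({x | x ≠ root} : Set ι).ncard :=
    (Set.ncard_le_ncard hsub (Set.toFinite _)).trans (Set.ncard_image_le (Set.toFinite _))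
  have h2 : ({x | x ≠ root} : Set ι).ncard + 1 = Nat.card ι := by
    have := Set.ncard_add_ncard_compl ({root} : Set ι)
    rw [Set.ncard_singleton] at this
    rw [← this, add_comm]
    rfl
  rw [← h2]
  exact Nat.add_le_add_right h1 1

/-- `f` and `par` describe a rooted tree-partition of the subgraph of `G` induced by `U`: the root
part is the set of `v` with `f v = none`, every other part is the set of `v` with `f v = some x`
for a representative `x` in that part, and `par x` is the label of its parent. Here
`h` is a height function, `w` bounds the sizes of the non-root parts and `e` bounds the numbers of
their children. -/
structure IsRootedPartition {V : Type*} [DecidableEq V] (G : SimpleGraph V) (w e : ℕ)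
    (U : Finset V) (f par : V → Option V) (h : V → ℕ) : Prop where
  rep : ∀ v ∈ U, ∀ x, f v = some x → x ∈ U ∧ f x = some x
  par_rep : ∀ v ∈ U, f v = some v → ∀ x, par v = some x → x ∈ U ∧ f x = some x ∧ h x < h v
  adj : ∀ u ∈ U, ∀ v ∈ U, G.Adj u v →
    f u = f v ∨ (f u).bind par = f v ∨ (f v).bind par = f u
  width : ∀ x, (U.filter fun v => f v = some x).card ≤ w
  deg : ∀ x, (U.filter fun v => f v = some v ∧ par v = some x).card ≤ e

/-- The subgraph of `G` induced by `U` has a rooted tree-partition with root part `R`, whose root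
has at most `c` children, with all other parts of size at most `w` and having at most `e`
children. -/
def HasRootedPartition {V : Type*} [DecidableEq V] (G : SimpleGraph V) (w e : ℕ)
    (U R : Finset V) (c : ℕ) : Prop :=
  ∃ f par h, IsRootedPartition G w e U f par h ∧ (U.filter fun v => f v = none) = R ∧
    (U.filter fun v => f v = some v ∧ par v = none).card ≤ c

section RootedPartition

variable {V : Type*} [DecidableEq V] {G : SimpleGraph V} {w e : ℕ}

lemma HasRootedPartition.single (U : Finset V) : HasRootedPartition G w e U U 0 :=
  ⟨fun _ => none, fun _ => none, fun _ => 0, ⟨by simp, by simp, by simp, by simp, by simp⟩,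
    by simp, by simp⟩

lemma HasRootedPartition.glue {U₁ U₂ R₁ R₂ : Finset V} {c₁ c₂ : ℕ}
    (h₁ : HasRootedPartition G w e U₁ R₁ c₁) (h₂ : HasRootedPartition G w e U₂ R₂ c₂)
    (hR₁ : U₁ ∩ U₂ ⊆ R₁) (hR₂ : U₁ ∩ U₂ ⊆ R₂)
    (hadj : ∀ u ∈ U₁, ∀ v ∈ U₂, G.Adj u v → u ∈ U₂ ∨ v ∈ U₁) :
    HasRootedPartition G w e (U₁ ∪ U₂) (R₁ ∪ R₂) (c₁ + c₂) := by
  obtain ⟨f₁, p₁, k₁, H₁, rfl, hc₁⟩ := h₁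
  obtain ⟨f₂, p₂, k₂, H₂, rfl, hc₂⟩ := h₂
  have n₁ : ∀ v, v ∈ U₁ → v ∈ U₂ → f₁ v = none := fun v a b =>
    (Finset.mem_filter.1 (hR₁ (Finset.mem_inter.2 ⟨a, b⟩))).2
  have n₂ : ∀ v, v ∈ U₁ → v ∈ U₂ → f₂ v = none := fun v a b =>
    (Finset.mem_filter.1 (hR₂ (Finset.mem_inter.2 ⟨a, b⟩))).2
  set f : V → Option V := fun v => if v ∈ U₁ then f₁ v else f₂ v with hf
  set p : V → Option V := fun v => if v ∈ U₁ then p₁ v else p₂ v with hp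
  set k : V → ℕ := fun v => if v ∈ U₁ then k₁ v else k₂ v with hk
  have fe₁ : ∀ v ∈ U₁, f v = f₁ v := fun v hv => by simp [hf, hv]
  have fe₂ : ∀ v ∈ U₂, f v = f₂ v := fun v hv => by
    by_cases h : v ∈ U₁
    · rw [fe₁ v h, n₁ v h hv, n₂ v h hv]
    · simp [hf, h]
  have dj : ∀ v ∈ U₂, ∀ x, f₂ v = some x → v ∉ U₁ := by
    intro v hv x hx h
    rw [n₂ v h hv] at hx
    cases hx
  have b₁ : ∀ v ∈ U₁, (f₁ v).bind p = (f₁ v).bind p₁ := by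
    intro v hv
    cases hx : f₁ v with
    | none => rfl
    | some x => simp [hp, (H₁.rep v hv x hx).1]
  have b₂ : ∀ v ∈ U₂, (f₂ v).bind p = (f₂ v).bind p₂ := by
    intro v hv
    cases hx : f₂ v with
    | none => rfl
    | some x =>
      obtain ⟨hxU, hxx⟩ := H₂.rep v hv x hx
      simp [hp, dj x hxU x hxx]
  have a₁ : ∀ u ∈ U₁, ∀ v ∈ U₁, G.Adj u v →
      f u = f v ∨ (f u).bind p = f v ∨ (f v).bind p = f u := by
    intro u hu v hv huv
    rw [fe₁ u hu, fe₁ v hv, b₁ u hu, b₁ v hv]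
    exact H₁.adj u hu v hv huv
  have a₂ : ∀ u ∈ U₂, ∀ v ∈ U₂, G.Adj u v →
      f u = f v ∨ (f u).bind p = f v ∨ (f v).bind p = f u := by
    intro u hu v hv huv
    rw [fe₂ u hu, fe₂ v hv, b₂ u hu, b₂ v hv]
    exact H₂.adj u hu v hv huv
  have pr₁ : ∀ v ∈ U₁, f v = some v → p v = p₁ v := fun v hv _ => by simp [hp, hv]
  have pr₂ : ∀ v ∈ U₂, f v = some v → p v = p₂ v ∧ v ∉ U₁ := fun v hv h => by
    have := dj v hv v (fe₂ v hv ▸ h)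
    exact ⟨by simp [hp, this], this⟩
  refine ⟨f, p, k, ⟨?_, ?_, ?_, ?_, ?_⟩, ?_, ?_⟩
  · intro v hv x hx
    rcases Finset.mem_union.1 hv with hv | hv
    · obtain ⟨a, b⟩ := H₁.rep v hv x (fe₁ v hv ▸ hx)
      exact ⟨Finset.mem_union_left _ a, (fe₁ x a).trans b⟩
    · obtain ⟨a, b⟩ := H₂.rep v hv x (fe₂ v hv ▸ hx)
      exact ⟨Finset.mem_union_right _ a, (fe₂ x a).trans b⟩
  · intro v hv hvv x hx
    rcases Finset.mem_union.1 hv with hv | hv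
    · obtain ⟨a, b, c⟩ := H₁.par_rep v hv (fe₁ v hv ▸ hvv) x (pr₁ v hv hvv ▸ hx)
      exact ⟨Finset.mem_union_left _ a, (fe₁ x a).trans b, by simpa [hk, hv, a] using c⟩
    · obtain ⟨hpv, hv1⟩ := pr₂ v hv hvv
      obtain ⟨a, b, c⟩ := H₂.par_rep v hv (fe₂ v hv ▸ hvv) x (hpv ▸ hx)
      exact ⟨Finset.mem_union_right _ a, (fe₂ x a).trans b, by
        simpa [hk, hv1, dj x a x b] using c⟩
  · intro u hu v hv huv
    rcases Finset.mem_union.1 hu with hu | hu <;> rcases Finset.mem_union.1 hv with hv | hv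
    · exact a₁ u hu v hv huv
    · rcases hadj u hu v hv huv with h | h
      · exact a₂ u h v hv huv
      · exact a₁ u hu v h huv
    · rcases hadj v hv u hu huv.symm with h | h
      · exact a₂ u hu v h huv
      · exact a₁ u h v hv huv
    · exact a₂ u hu v hv huv
  · intro x
    by_cases hx : x ∈ U₁
    · refine (Finset.card_le_card ?_).trans (H₁.width x)
      intro v hv
      rw [Finset.mem_filter, Finset.mem_union] at hv
      obtain ⟨hv | hv, hvx⟩ := hv
      · exact Finset.mem_filter.2 ⟨hv, fe₁ v hv ▸ hvx⟩
      · obtain ⟨a, b⟩ := H₂.rep v hv x (fe₂ v hv ▸ hvx)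
        exact absurd hx (dj x a x b)
    · refine (Finset.card_le_card ?_).trans (H₂.width x)
      intro v hv
      rw [Finset.mem_filter, Finset.mem_union] at hv
      obtain ⟨hv | hv, hvx⟩ := hv
      · exact absurd (H₁.rep v hv x (fe₁ v hv ▸ hvx)).1 hx
      · exact Finset.mem_filter.2 ⟨hv, fe₂ v hv ▸ hvx⟩
  · intro x
    by_cases hx : x ∈ U₁
    · refine (Finset.card_le_card ?_).trans (H₁.deg x)
      intro v hv
      rw [Finset.mem_filter, Finset.mem_union] at hv
      obtain ⟨hv | hv, hvv, hvx⟩ := hv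
      · exact Finset.mem_filter.2 ⟨hv, fe₁ v hv ▸ hvv, pr₁ v hv hvv ▸ hvx⟩
      · obtain ⟨a, b, -⟩ := H₂.par_rep v hv (fe₂ v hv ▸ hvv) x ((pr₂ v hv hvv).1 ▸ hvx)
        exact absurd hx (dj x a x b)
    · refine (Finset.card_le_card ?_).trans (H₂.deg x)
      intro v hv
      rw [Finset.mem_filter, Finset.mem_union] at hv
      obtain ⟨hv | hv, hvv, hvx⟩ := hv
      · exact absurd (H₁.par_rep v hv (fe₁ v hv ▸ hvv) x (pr₁ v hv hvv ▸ hvx)).1 hx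
      · exact Finset.mem_filter.2 ⟨hv, fe₂ v hv ▸ hvv, (pr₂ v hv hvv).1 ▸ hvx⟩
  · rw [Finset.filter_union]
    congr 1
    · exact Finset.filter_congr fun v hv => by rw [fe₁ v hv]
    · exact Finset.filter_congr fun v hv => by rw [fe₂ v hv]
  · rw [Finset.filter_union]
    refine (Finset.card_union_le _ _).trans (add_le_add ?_ ?_)
    · refine (Finset.card_le_card ?_).trans hc₁
      intro v hv
      obtain ⟨hv, hvv, hvx⟩ := Finset.mem_filter.1 hv
      exact Finset.mem_filter.2 ⟨hv, fe₁ v hv ▸ hvv, pr₁ v hv hvv ▸ hvx⟩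
    · refine (Finset.card_le_card ?_).trans hc₂
      intro v hv
      obtain ⟨hv, hvv, hvx⟩ := Finset.mem_filter.1 hv
      exact Finset.mem_filter.2 ⟨hv, fe₂ v hv ▸ hvv, (pr₂ v hv hvv).1 ▸ hvx⟩

lemma HasRootedPartition.addRoot {U R S : Finset V} {c : ℕ}
    (H : HasRootedPartition G w e U R c) (hR : R.Nonempty) (hRw : R.card ≤ w) (hc : c ≤ e)
    (hS : Disjoint S U) (hadj : ∀ u ∈ S, ∀ v ∈ U, G.Adj u v → v ∈ R) :
    HasRootedPartition G w e (S ∪ U) S 1 := by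
  obtain ⟨f₀, p₀, k₀, H, rfl, hc₀⟩ := H
  obtain ⟨r, hr⟩ := hR
  obtain ⟨hrU, hrn⟩ := Finset.mem_filter.1 hr
  set f : V → Option V := fun v => if v ∈ S then none else some ((f₀ v).getD r) with hf
  set p : V → Option V := fun v => if v = r then none else some ((p₀ v).getD r) with hp
  set k : V → ℕ := fun v => if v = r then 0 else k₀ v + 1 with hk
  have hnS : ∀ v ∈ U, v ∉ S := fun v hv h => Finset.disjoint_left.1 hS h hv
  have fS : ∀ v ∈ S, f v = none := fun v hv => by simp [hf, hv]
  have fU : ∀ v ∈ U, f v = some ((f₀ v).getD r) := fun v hv => by simp [hf, hnS v hv]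
  have fr : f r = some r := by rw [fU r hrU, hrn]; rfl
  have ne_r : ∀ v ∈ U, ∀ x, f₀ v = some x → x ≠ r := by
    rintro v hv x hx rfl
    rw [(H.rep v hv x hx).2] at hrn
    cases hrn
  have frep : ∀ v ∈ U, f v = some v → v ≠ r → f₀ v = some v := by
    intro v hv hvv hne
    rw [fU v hv] at hvv
    cases hx : f₀ v with
    | none => simp [hx] at hvv; exact absurd hvv.symm hne
    | some x => simpa [hx] using hvv
  refine ⟨f, p, k, ⟨?_, ?_, ?_, ?_, ?_⟩, ?_, ?_⟩
  · intro v hv x hx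
    rcases Finset.mem_union.1 hv with hv | hv
    · rw [fS v hv] at hx; cases hx
    · rw [fU v hv] at hx
      cases hy : f₀ v with
      | none =>
        simp [hy] at hx
        subst hx
        exact ⟨Finset.mem_union_right _ hrU, fr⟩
      | some y =>
        simp [hy] at hx
        subst hx
        obtain ⟨a, b⟩ := H.rep v hv y hy
        exact ⟨Finset.mem_union_right _ a, by rw [fU y a, b]; rfl⟩
  · intro v hv hvv x hx
    rcases Finset.mem_union.1 hv with hv | hv
    · rw [fS v hv] at hvv; cases hvv
    · have hne : v ≠ r := by
        rintro rfl
        simp [hp] at hx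
      have h0 := frep v hv hvv hne
      cases hy : p₀ v with
      | none =>
        simp [hp, hne, hy] at hx
        subst hx
        exact ⟨Finset.mem_union_right _ hrU, fr, by simp [hk, hne]⟩
      | some y =>
        simp [hp, hne, hy] at hx
        subst hx
        obtain ⟨a, b, c⟩ := H.par_rep v hv h0 y hy
        exact ⟨Finset.mem_union_right _ a, by rw [fU y a, b]; rfl,
          by simpa [hk, hne, ne_r y a y b] using c⟩
  · have hSU : ∀ u ∈ S, ∀ v ∈ U, G.Adj u v → (f v).bind p = f u := by
      intro u hu v hv huv
      have := (Finset.mem_filter.1 (hadj u hu v hv huv)).2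
      rw [fS u hu, fU v hv, this]
      simp [hp]
    have hb : ∀ u ∈ U, ∀ v ∈ U, (f₀ u).bind p₀ = f₀ v → f u = f v ∨ (f u).bind p = f v := by
      intro u hu v hv h
      rw [fU u hu, fU v hv, ← h]
      cases hy : f₀ u with
      | none => left; rfl
      | some y => right; simp [hp, ne_r u hu y hy]
    intro u hu v hv huv
    rcases Finset.mem_union.1 hu with hu | hu <;> rcases Finset.mem_union.1 hv with hv | hv
    · left; rw [fS u hu, fS v hv]
    · exact Or.inr (Or.inr (hSU u hu v hv huv))
    · exact Or.inr (Or.inl (hSU v hv u hu huv.symm))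
    · rcases H.adj u hu v hv huv with h | h | h
      · left; rw [fU u hu, fU v hv, h]
      · exact (hb u hu v hv h).imp_right Or.inl
      · exact (hb v hv u hu h).imp Eq.symm Or.inr
  · intro x
    by_cases hx : x = r
    · subst hx
      refine (Finset.card_le_card ?_).trans hRw
      intro v hv
      obtain ⟨hv, hvx⟩ := Finset.mem_filter.1 hv
      rcases Finset.mem_union.1 hv with hv | hv
      · rw [fS v hv] at hvx; cases hvx
      · refine Finset.mem_filter.2 ⟨hv, ?_⟩
        rw [fU v hv] at hvx
        cases hy : f₀ v with
        | none => rfl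
        | some y => exact absurd (by simpa [hy] using hvx) (ne_r v hv y hy)
    · refine (Finset.card_le_card ?_).trans (H.width x)
      intro v hv
      obtain ⟨hv, hvx⟩ := Finset.mem_filter.1 hv
      rcases Finset.mem_union.1 hv with hv | hv
      · rw [fS v hv] at hvx; cases hvx
      · refine Finset.mem_filter.2 ⟨hv, ?_⟩
        rw [fU v hv] at hvx
        cases hy : f₀ v with
        | none => simp [hy] at hvx; exact absurd hvx.symm hx
        | some y => simpa [hy] using hvx
  · intro x
    have key : ∀ v ∈ S ∪ U, f v = some v → p v = some x →
        v ∈ U ∧ f₀ v = some v ∧ (p₀ v).getD r = x := by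
      intro v hv hvv hvx
      rcases Finset.mem_union.1 hv with hv | hv
      · rw [fS v hv] at hvv; cases hvv
      · have hne : v ≠ r := by
          rintro rfl
          simp [hp] at hvx
        refine ⟨hv, frep v hv hvv hne, ?_⟩
        simpa [hp, hne] using hvx
    by_cases hx : x = r
    · refine (Finset.card_le_card ?_).trans (hc₀.trans hc)
      intro v hv
      obtain ⟨hv, hvv, hvx⟩ := Finset.mem_filter.1 hv
      obtain ⟨a, b, c⟩ := key v hv hvv hvx
      refine Finset.mem_filter.2 ⟨a, b, ?_⟩
      cases hy : p₀ v with
      | none => rfl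
      | some y =>
        obtain ⟨a', b', -⟩ := H.par_rep v a b y hy
        rw [hy] at c
        exact absurd (c.trans hx) (ne_r y a' y b')
    · refine (Finset.card_le_card ?_).trans (H.deg x)
      intro v hv
      obtain ⟨hv, hvv, hvx⟩ := Finset.mem_filter.1 hv
      obtain ⟨a, b, c⟩ := key v hv hvv hvx
      refine Finset.mem_filter.2 ⟨a, b, ?_⟩
      cases hy : p₀ v with
      | none => rw [hy] at c; exact absurd c.symm hx
      | some y => rw [hy] at c; exact congrArg some c
  · ext v
    rw [Finset.mem_filter, Finset.mem_union]
    constructor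
    · rintro ⟨hv | hv, h⟩
      · exact hv
      · rw [fU v hv] at h; cases h
    · exact fun hv => ⟨Or.inl hv, fS v hv⟩
  · refine (Finset.card_le_card (t := {r}) fun v hv => ?_).trans_eq (Finset.card_singleton r)
    obtain ⟨-, -, hvx⟩ := Finset.mem_filter.1 hv
    by_contra hne
    rw [Finset.mem_singleton] at hne
    simp [hp, hne] at hvx

end RootedPartition

lemma HasRootedPartition.exists_isTreePartition {V : Type} [Fintype V] [DecidableEq V]
    {G : SimpleGraph V} {w e c : ℕ} {R : Finset V}
    (H : HasRootedPartition G w e Finset.univ R c) (hR : R.Nonempty) (hRw : R.card ≤ w)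
    (hc : c ≤ e + 1) :
    ∃ (ι : Type) (_ : Fintype ι) (T : SimpleGraph ι) (B : ι → Set V),
      IsTreePartition G T B ∧ (∀ x, (B x).ncard ≤ w) ∧
      (∀ x, (T.neighborSet x).ncard ≤ e + 1) := by
  obtain ⟨f, par, h, H, rfl, hc⟩ := H
  obtain ⟨r, hr⟩ := hR
  replace hr := (Finset.mem_filter.1 hr).2
  have hrep : ∀ x : Set.range f, x.1 = none ∨ ∃ v, x.1 = some v ∧ f v = some v := by
    rintro ⟨_, v, rfl⟩
    change f v = none ∨ ∃ u, f v = some u ∧ f u = some u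
    rcases hx : f v with _ | x
    · exact Or.inl rfl
    · exact Or.inr ⟨x, rfl, (H.rep v (Finset.mem_univ _) x hx).2⟩
  have hpar : ∀ x : Set.range f, x.1.bind par ∈ Set.range f := by
    intro x
    rcases hrep x with hx | ⟨v, hx, hv⟩
    · rw [hx]; exact ⟨r, hr⟩
    · rw [hx]
      cases hy : par v with
      | none => exact ⟨r, by simpa [hy] using hr⟩
      | some y => exact ⟨y, by simpa [hy] using (H.par_rep v (Finset.mem_univ _) hv y hy).2.1⟩
  let root : Set.range f := ⟨none, r, hr⟩
  let p : Set.range f → Set.range f := fun x => ⟨x.1.bind par, hpar x⟩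
  let k : Set.range f → ℕ := fun x => x.1.elim 0 fun v => h v + 1
  refine ⟨Set.range f, Fintype.ofFinite _, SimpleGraph.fromRel fun x y => p x = y,
    fun x => {v | f v = x.1}, ⟨?_, ?_, ?_, ?_⟩, ?_, ?_⟩
  · refine isTree_fromRel_parent root p k ?_ rfl
    intro x hx
    rcases hrep x with hx' | ⟨v, hx', hv⟩
    · exact absurd (Subtype.ext hx') hx
    · simp only [k, p, hx', Option.bind_some, Option.elim_some]
      cases hy : par v with
      | none => simp
      | some y => simpa using (H.par_rep v (Finset.mem_univ _) hv y hy).2.2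
  · rintro ⟨_, v, rfl⟩
    exact ⟨v, rfl⟩
  · intro v
    exact ⟨⟨f v, v, rfl⟩, rfl, fun y hy => Subtype.ext hy.symm⟩
  · intro v u x y hvu hv hu
    simp only [Set.mem_ofPred_eq] at hv hu
    by_cases hxy : x = y
    · exact Or.inl hxy
    right
    rw [SimpleGraph.fromRel_adj]
    refine ⟨hxy, ?_⟩
    rcases H.adj v (Finset.mem_univ _) u (Finset.mem_univ _) hvu with h' | h' | h'
    · exact absurd (Subtype.ext (hv.symm.trans (h'.trans hu))) hxy
    · exact Or.inl (Subtype.ext (by simp only [p]; rw [← hv, ← hu, h']))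
    · exact Or.inr (Subtype.ext (by simp only [p]; rw [← hv, ← hu, h']))
  · intro x
    have : {v | f v = x.1} = (↑(Finset.univ.filter fun v => f v = x.1) : Set V) := by simp
    simp only [this, Set.ncard_coe_finset]
    cases hx : x.1 with
    | none => exact hRw
    | some y => exact H.width y
  · intro x
    have hch : ∀ y : Set.range f, y ≠ x → p y = x →
        y.1 ∈ some '' (↑(Finset.univ.filter fun v => f v = some v ∧ par v = x.1) : Set V) := by
      intro y hy hyx
      have hyx' : y.1.bind par = x.1 := congrArg Subtype.val hyx
      rcases hrep y with h' | ⟨v, h', hv⟩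
      · rw [h'] at hyx'
        exact absurd (Subtype.ext (h'.trans hyx')) hy
      · rw [h'] at hyx'
        exact ⟨v, by simpa using ⟨hv, hyx'⟩, h'.symm⟩
    have hcc : ((some '' (↑(Finset.univ.filter fun v => f v = some v ∧ par v = x.1) :
        Set V)) : Set (Option V)).ncard =
        (Finset.univ.filter fun v => f v = some v ∧ par v = x.1).card := by
      rw [Set.ncard_image_of_injective _ (Option.some_injective V), Set.ncard_coe_finset]
    rw [← Set.ncard_image_of_injective _ Subtype.val_injective]
    rcases hx : x.1 with _ | y
    · refine (Set.ncard_le_ncard (t := some '' (↑(Finset.univ.filter fun v =>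
        f v = some v ∧ par v = x.1) : Set V)) ?_ (Set.toFinite _)).trans ?_
      · rintro _ ⟨z, hz, rfl⟩
        rw [SimpleGraph.mem_neighborSet, SimpleGraph.fromRel_adj] at hz
        obtain ⟨hne, hz | hz⟩ := hz
        · exfalso
          refine hne (hz ▸ Subtype.ext ?_)
          simp [p, hx]
        · exact hch z hne.symm hz
      · rw [hcc, hx]; omega
    · refine (Set.ncard_le_ncard (t := insert (p x).1 (some '' (↑(Finset.univ.filter fun v =>
        f v = some v ∧ par v = x.1) : Set V))) ?_ (Set.toFinite _)).trans ?_
      · rintro _ ⟨z, hz, rfl⟩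
        rw [SimpleGraph.mem_neighborSet, SimpleGraph.fromRel_adj] at hz
        obtain ⟨hne, hz | hz⟩ := hz
        · exact Or.inl (congrArg Subtype.val hz.symm)
        · exact Or.inr (hch z hne.symm hz)
      · refine (Set.ncard_insert_le _ _).trans ?_
        rw [hcc, hx]
        exact Nat.add_le_add_right (H.deg y) 1

/-- If a vertex `v` whose bags induce a connected subgraph of `T` is not in the bag of `x`, then a
set `C` of nodes that can only be left through `x` contains all or none of the bags with `v`. -/
lemma mem_of_mem_bag_of_closed {V ι : Type*} {T : SimpleGraph ι} {B : ι → Finset V} {v : V}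
    (hv : (T.induce {x | v ∈ B x}).Preconnected) {x : ι} {C : Finset ι}
    (hC : ∀ y ∈ C, ∀ z, T.Adj y z → z ≠ x → z ∈ C) (hx : v ∉ B x) {y z : ι} (hy : y ∈ C)
    (hvy : v ∈ B y) (hvz : v ∈ B z) : z ∈ C := by
  by_contra hz
  obtain ⟨p⟩ := hv ⟨y, hvy⟩ ⟨z, hvz⟩
  obtain ⟨⟨⟨a, b⟩, hab⟩, -, ha, hb⟩ := p.exists_boundary_dart {t | t.1 ∈ C} hy hz
  refine hb (hC a.1 ha b.1 hab ?_)
  rintro rfl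
  exact hx b.2

/-- A balanced separator: one bag `B x` of a tree-decomposition separates a set `Q` from the rest
so that each side, together with the bag, carries a third of the weight of `S`. -/
lemma exists_balanced_bag {V ι : Type*} [DecidableEq V] [Finite ι] {T : SimpleGraph ι}
    (hT : T.IsTree) (B : ι → Finset V)
    (hB : ∀ v, (T.induce {x | v ∈ B x}).Preconnected) {m : ℕ} {S : Finset V}
    (hSB : ∀ v ∈ S, ∃ x, v ∈ B x)     (hS : 3 * m ≤ S.card) (hBm : ∀ x, (B x).card < m) :
    ∃ (x : ι) (Q : Finset V), (∀ v ∈ Q, v ∉ B x) ∧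
      (∀ y, ∀ u ∈ B y, u ∈ Q → ∀ v ∈ B y, v ∈ Q ∨ v ∈ B x) ∧
      m ≤ (S ∩ Q).card + (B x).card ∧ m ≤ (S \ (Q ∪ B x)).card + (B x).card := by
  classical
  have := Fintype.ofFinite ι
  have hsplit : ∀ Q X : Finset V, S.card ≤ (S ∩ Q).card + X.card + (S \ (Q ∪ X)).card := by
    intro Q X
    refine (Finset.card_le_card (t := (S ∩ Q) ∪ X ∪ (S \ (Q ∪ X))) ?_).trans
      ((Finset.card_union_le _ _).trans (Nat.add_le_add_right (Finset.card_union_le _ _) _))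
    intro v hv
    simp only [Finset.mem_union, Finset.mem_inter, Finset.mem_sdiff]
    tauto
  have main : ∀ n : ℕ, ∀ (x : ι) (C : Finset ι), C.card = n → x ∉ C →
      (∀ y ∈ C, ∀ z, T.Adj y z → z ≠ x → z ∈ C) →
      m ≤ (S ∩ (C.biUnion B \ B x)).card + (B x).card →
      ∃ (x : ι) (Q : Finset V), (∀ v ∈ Q, v ∉ B x) ∧
        (∀ y, ∀ u ∈ B y, u ∈ Q → ∀ v ∈ B y, v ∈ Q ∨ v ∈ B x) ∧
        m ≤ (S ∩ Q).card + (B x).card ∧ m ≤ (S \ (Q ∪ B x)).card + (B x).card := by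
    intro n
    induction n using Nat.strong_induction_on with
    | _ n ih =>
      intro x C hn hxC hC hw
      by_cases hr : m ≤ (S \ ((C.biUnion B \ B x) ∪ B x)).card + (B x).card
      · refine ⟨x, C.biUnion B \ B x, fun v hv => (Finset.mem_sdiff.1 hv).2, ?_, hw, hr⟩
        intro y u huy hu v hvy
        obtain ⟨hu, hux⟩ := Finset.mem_sdiff.1 hu
        obtain ⟨c, hc, huc⟩ := Finset.mem_biUnion.1 hu
        have hy : y ∈ C := mem_of_mem_bag_of_closed (hB u) hC hux hc huc huy
        by_cases hvx : v ∈ B x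
        · exact Or.inr hvx
        · exact Or.inl (Finset.mem_sdiff.2 ⟨Finset.mem_biUnion.2 ⟨y, hy, hvy⟩, hvx⟩)
      have hbig := hsplit (C.biUnion B \ B x) (B x)
      have hxm := hBm x
      have hCne : C.Nonempty := by
        rw [Finset.nonempty_iff_ne_empty]
        rintro rfl
        simp at hw
        omega
      obtain ⟨y, hyC, hxy⟩ : ∃ y ∈ C, T.Adj y x := by
        obtain ⟨c, hc⟩ := hCne
        obtain ⟨p⟩ := hT.connected.preconnected c x
        obtain ⟨⟨⟨a, b⟩, hab⟩, -, ha, hb⟩ := p.exists_boundary_dart (C : Set ι) hc hxC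
        refine ⟨a, ha, ?_⟩
        by_cases hbx : b = x
        · exact hbx ▸ hab
        · exact absurd (hC a ha b hab hbx) hb
      set T' := T.deleteEdges {s(y, x)} with hT'
      have hyx : ¬ T'.Reachable y x :=
        SimpleGraph.isBridge_iff.1 (SimpleGraph.isAcyclic_iff_forall_adj_isBridge.1 hT.isAcyclic hxy)
      have hstep : ∀ a b, T.Adj a b → a ≠ x → b ≠ x → T'.Adj a b := by
        intro a b hab ha hb
        rw [hT', SimpleGraph.deleteEdges_adj]
        refine ⟨hab, ?_⟩
        simp only [Set.mem_singleton_iff, Sym2.eq_iff]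
        tauto
      set C₁ := C.filter fun z => T'.Reachable y z
      set C₂ := C.filter fun z => ¬ T'.Reachable y z
      have hneC : ∀ a ∈ C, a ≠ x := fun a ha h => hxC (h ▸ ha)
      rcases C₂.eq_empty_or_nonempty with he | hne
      · have hall : ∀ z ∈ C, T'.Reachable y z := by
          intro z hz
          by_contra h
          exact Finset.notMem_empty z (he ▸ Finset.mem_filter.2 ⟨hz, h⟩)
        by_cases hwy : m ≤ (S ∩ ((C.erase y).biUnion B \ B y)).card + (B y).card
        · refine ih _ ?_ y (C.erase y) rfl (Finset.notMem_erase _ _) ?_ hwy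
          · rw [← hn]
            exact Finset.card_erase_lt_of_mem hyC
          · intro a ha z haz hzy
            obtain ⟨hay, haC⟩ := Finset.mem_erase.1 ha
            refine Finset.mem_erase.2 ⟨hzy, hC a haC z haz ?_⟩
            rintro rfl
            refine hyx ((hall a haC).trans (SimpleGraph.Adj.reachable ?_))
            rw [hT', SimpleGraph.deleteEdges_adj]
            refine ⟨haz, ?_⟩
            simp only [Set.mem_singleton_iff, Sym2.eq_iff]
            rintro (⟨h, -⟩ | ⟨h, -⟩)
            · exact hay h
            · exact hneC a haC h
        · exfalso
          have hle : (S ∩ (C.biUnion B \ B x)).card ≤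
              (S ∩ ((C.erase y).biUnion B \ B y)).card + (B y).card := by
            refine (Finset.card_le_card (t := (S ∩ ((C.erase y).biUnion B \ B y)) ∪ B y)
              ?_).trans (Finset.card_union_le _ _)
            intro v hv
            rw [Finset.mem_inter, Finset.mem_sdiff, Finset.mem_biUnion] at hv
            obtain ⟨hvS, ⟨c, hc, hvc⟩, -⟩ := hv
            by_cases hvy : v ∈ B y
            · exact Finset.mem_union_right _ hvy
            · refine Finset.mem_union_left _ (Finset.mem_inter.2 ⟨hvS, Finset.mem_sdiff.2
                ⟨Finset.mem_biUnion.2 ⟨c, Finset.mem_erase.2 ⟨?_, hc⟩, hvc⟩, hvy⟩⟩)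
              rintro rfl
              exact hvy hvc
          omega
      · have hsub₁ : C₁.card < n := by
          rw [← hn]
          refine Finset.card_lt_card ⟨Finset.filter_subset _ _, fun h => ?_⟩
          obtain ⟨z, hz⟩ := hne
          obtain ⟨hzC, hz⟩ := Finset.mem_filter.1 hz
          exact hz (Finset.mem_filter.1 (h hzC)).2
        have hsub₂ : C₂.card < n := by
          rw [← hn]
          refine Finset.card_lt_card ⟨Finset.filter_subset _ _, fun h => ?_⟩
          exact (Finset.mem_filter.1 (h hyC)).2 (SimpleGraph.Reachable.refl y)
        by_cases hw₁ : m ≤ (S ∩ (C₁.biUnion B \ B x)).card + (B x).card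
        · refine ih _ hsub₁ x C₁ rfl (fun h => hxC (Finset.mem_filter.1 h).1) ?_ hw₁
          intro a ha z haz hzx
          obtain ⟨haC, ha⟩ := Finset.mem_filter.1 ha
          exact Finset.mem_filter.2 ⟨hC a haC z haz hzx,
            ha.trans (hstep a z haz (hneC a haC) hzx).reachable⟩
        by_cases hw₂ : m ≤ (S ∩ (C₂.biUnion B \ B x)).card + (B x).card
        · refine ih _ hsub₂ x C₂ rfl (fun h => hxC (Finset.mem_filter.1 h).1) ?_ hw₂
          intro a ha z haz hzx
          obtain ⟨haC, ha⟩ := Finset.mem_filter.1 ha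
          exact Finset.mem_filter.2 ⟨hC a haC z haz hzx,
            fun h => ha (h.trans (hstep a z haz (hneC a haC) hzx).reachable.symm)⟩
        exfalso
        have hle : (S ∩ (C.biUnion B \ B x)).card ≤
            (S ∩ (C₁.biUnion B \ B x)).card + (S ∩ (C₂.biUnion B \ B x)).card := by
          refine (Finset.card_le_card ?_).trans (Finset.card_union_le _ _)
          rw [← Finset.inter_union_distrib_left, ← Finset.union_sdiff_distrib,
            ← Finset.union_biUnion, Finset.filter_union_filter_not_eq]
        omega
  obtain ⟨x⟩ := hT.connected.nonempty
  refine main _ x (Finset.univ.erase x) rfl (Finset.notMem_erase _ _)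
    (fun y _ z _ hzx => Finset.mem_erase.2 ⟨hzx, Finset.mem_univ _⟩) ?_
  have hle : S.card ≤ (S ∩ ((Finset.univ.erase x).biUnion B \ B x)).card + (B x).card := by
    refine (Finset.card_le_card fun v hv => ?_).trans (Finset.card_union_le _ _)
    by_cases hvx : v ∈ B x
    · exact Finset.mem_union_right _ hvx
    · obtain ⟨c, hc⟩ := hSB v hv
      refine Finset.mem_union_left _ (Finset.mem_inter.2 ⟨hv, Finset.mem_sdiff.2
        ⟨Finset.mem_biUnion.2 ⟨c, Finset.mem_erase.2 ⟨?_, Finset.mem_univ _⟩, hc⟩, hvx⟩⟩)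
      rintro rfl
      exact hvx hc
  omega

/-- Given a tree-decomposition of `G` with bags of size at most `k`, every set `S` of moderate size
is contained in the root part of a rooted tree-partition whose root part and root degree are
bounded linearly in `S.card`. -/
lemma hasRootedPartition_of_isTreeDecomp {V ι : Type*} [DecidableEq V] [Finite ι]
    {G : SimpleGraph V} {T : SimpleGraph ι} {B : ι → Finset V} {k d : ℕ} (hk : 1 ≤ k) (hd : 1 ≤ d)
    (hB : IsTreeDecomp G T fun x => (B x : Set V)) (hBk : ∀ x, (B x).card ≤ k)
    (hG : ∀ v, ∃ N : Finset V, N.card ≤ d ∧ ∀ u, G.Adj v u → u ∈ N)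
    (U S : Finset V) (hSU : S ⊆ U) (hS₁ : 4 * k ≤ S.card) (hS₂ : S.card ≤ 12 * k * d) :
    ∃ R c, HasRootedPartition G (18 * k * d) (6 * d - 1) U R c ∧ S ⊆ R ∧
      2 * R.card + 4 * k ≤ 3 * S.card ∧ 2 * k * (c + 1) ≤ S.card := by
  classical
  induction hn : U.card using Nat.strong_induction_on generalizing U S with
  | _ n ih =>
  have hkd : k ≤ k * d := Nat.le_mul_of_pos_right k hd
  have hassoc₁ : 18 * k * d = 18 * (k * d) := by ring
  have hassoc₂ : 12 * k * d = 12 * (k * d) := by ring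
  by_cases hsmall : (U \ S).card ≤ 18 * k * d
  · rcases (U \ S).eq_empty_or_nonempty with he | hne
    · have : U = S := (Finset.sdiff_eq_empty_iff_subset.1 he).antisymm hSU
      subst this
      exact ⟨U, 0, HasRootedPartition.single U, subset_rfl, by omega, by omega⟩
    · refine ⟨S, 1, ?_, subset_rfl, by omega, by omega⟩
      have := (HasRootedPartition.single (G := G) (w := 18 * k * d) (e := 6 * d - 1)
        (U \ S)).addRoot hne hsmall (Nat.zero_le _) Finset.disjoint_sdiff
        (fun _ _ v hv _ => hv)
      rwa [Finset.union_sdiff_of_subset hSU] at this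
  by_cases hS : S.card ≤ 12 * k
  · choose N hNd hN using hG
    have hcard : (S.biUnion N ∩ (U \ S)).card ≤ 12 * k * d := by
      calc _ ≤ (S.biUnion N).card := Finset.card_le_card Finset.inter_subset_left
        _ ≤ S.card * d := Finset.card_biUnion_le_card_mul _ _ _ fun v _ => hNd v
        _ ≤ _ := Nat.mul_le_mul_right d hS
    obtain ⟨S', hNS', hS'U, hS'k, hS'd⟩ : ∃ S', S.biUnion N ∩ (U \ S) ⊆ S' ∧ S' ⊆ U \ S ∧
        4 * k ≤ S'.card ∧ S'.card ≤ 12 * k * d := by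
      obtain ⟨S', h1, h2, h3⟩ := Finset.exists_subsuperset_card_eq
        (s := S.biUnion N ∩ (U \ S)) (t := U \ S)
        (n := max (4 * k) (S.biUnion N ∩ (U \ S)).card) Finset.inter_subset_right
        (le_max_right _ _)
        (max_le (by omega) (Finset.card_le_card Finset.inter_subset_right))
      exact ⟨S', h1, h2, by omega, by omega⟩
    have hlt : (U \ S).card < n := by
      rw [← hn, Finset.card_sdiff_of_subset hSU]
      have := Finset.card_le_card hSU
      omega
    obtain ⟨R, c, h1, h2, h3, h4⟩ := ih _ hlt (U \ S) S' hS'U hS'k hS'd rfl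
    refine ⟨S, 1, ?_, subset_rfl, by omega, by omega⟩
    have hc : 2 * k * (c + 1) ≤ 2 * k * (6 * d) := h4.trans (hS'd.trans_eq (by ring))
    have hc' := Nat.le_of_mul_le_mul_left hc (by omega)
    have := h1.addRoot ((Finset.card_pos.1 (by omega)).mono h2) (by omega) (by omega)
      Finset.disjoint_sdiff fun u hu v hv huv =>
        h2 (hNS' (Finset.mem_inter.2 ⟨Finset.mem_biUnion.2 ⟨u, hu, hN u v huv⟩, hv⟩))
    rwa [Finset.union_sdiff_of_subset hSU] at this
  push Not at hS hsmall
  obtain ⟨x, Q, hQ₁, hQ₂, hQ₃, hQ₄⟩ := exists_balanced_bag hB.isTree (fun x => B x ∩ U)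
    (fun v => by
      by_cases hv : v ∈ U
      · have h : {y | v ∈ B y ∩ U} = {y | v ∈ (B y : Set V)} := by
          ext y
          simp [hv]
        rw [h]
        exact (hB.subtree v).preconnected
      · rintro ⟨y, hy⟩
        simp [hv] at hy)
    (m := 4 * k) (S := S) (fun v hv => by
      obtain ⟨y, hy⟩ := (hB.subtree v).nonempty
      exact ⟨y, Finset.mem_inter.2 ⟨hy, hSU hv⟩⟩) (by omega) (fun x =>
      (Finset.card_le_card Finset.inter_subset_left).trans_lt ((hBk x).trans_lt (by omega)))
  have hXk : (B x ∩ U).card ≤ k := (Finset.card_le_card Finset.inter_subset_left).trans (hBk x)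
  set X := B x ∩ U
  set S₁ := S ∩ Q
  set S₂ := S \ (Q ∪ X)
  set U₁ := U ∩ (Q ∪ X)
  set U₂ := U \ Q
  have hXU : X ⊆ U := Finset.inter_subset_right
  have hS₁Q : ∀ v, v ∈ S₁ ↔ v ∈ S ∧ v ∈ Q := fun v => Finset.mem_inter
  have hS₂Q : ∀ v, v ∈ S₂ ↔ v ∈ S ∧ v ∉ Q ∧ v ∉ X := fun v => by
    rw [Finset.mem_sdiff, Finset.mem_union, not_or]
  have hU₁Q : ∀ v, v ∈ U₁ ↔ v ∈ U ∧ (v ∈ Q ∨ v ∈ X) := fun v => by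
    rw [Finset.mem_inter, Finset.mem_union]
  have hU₂Q : ∀ v, v ∈ U₂ ↔ v ∈ U ∧ v ∉ Q := fun v => Finset.mem_sdiff
  have hU : U₁ ∪ U₂ = U := by
    ext v
    rw [Finset.mem_union, hU₁Q, hU₂Q]
    tauto
  have hUX : U₁ ∩ U₂ = X := by
    ext v
    rw [Finset.mem_inter, hU₁Q, hU₂Q]
    have := @hXU v
    have := hQ₁ v
    tauto
  have hd₁ : Disjoint S₁ X := Finset.disjoint_left.2 fun v h => hQ₁ v ((hS₁Q v).1 h).2
  have hd₂ : Disjoint S₂ X := Finset.disjoint_left.2 fun v h => ((hS₂Q v).1 h).2.2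
  have hd₁₂ : Disjoint S₁ S₂ := Finset.disjoint_left.2 fun v h h' =>
    ((hS₂Q v).1 h').2.1 ((hS₁Q v).1 h).2
  have hsum : S₁.card + S₂.card ≤ S.card := by
    rw [← Finset.card_union_of_disjoint hd₁₂]
    exact Finset.card_le_card
      (Finset.union_subset Finset.inter_subset_left Finset.sdiff_subset)
  have hc₁ := Finset.card_union_of_disjoint hd₁
  have hc₂ := Finset.card_union_of_disjoint hd₂
  have hlt₁ : U₁.card < n := by
    rw [← hn]
    refine Finset.card_lt_card ⟨Finset.inter_subset_left, fun h => ?_⟩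
    obtain ⟨v, hv⟩ : S₂.Nonempty := Finset.card_pos.1 (by omega)
    rw [hS₂Q] at hv
    have := (hU₁Q v).1 (h (hSU hv.1))
    tauto
  have hlt₂ : U₂.card < n := by
    rw [← hn]
    refine Finset.card_lt_card ⟨Finset.sdiff_subset, fun h => ?_⟩
    obtain ⟨v, hv⟩ : S₁.Nonempty := Finset.card_pos.1 (by omega)
    rw [hS₁Q] at hv
    have := (hU₂Q v).1 (h (hSU hv.1))
    tauto
  have hsub₁ : S₁ ∪ X ⊆ U₁ := by
    intro v
    rw [Finset.mem_union, hS₁Q, hU₁Q]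
    have := @hXU v
    have := @hSU v
    tauto
  have hsub₂ : S₂ ∪ X ⊆ U₂ := by
    intro v
    rw [Finset.mem_union, hS₂Q, hU₂Q]
    have := @hXU v
    have := @hSU v
    have := hQ₁ v
    tauto
  obtain ⟨R₁, c₁, h₁, hR₁, hw₁, he₁⟩ := ih _ hlt₁ U₁ (S₁ ∪ X) hsub₁ (by omega) (by omega) rfl
  obtain ⟨R₂, c₂, h₂, hR₂, hw₂, he₂⟩ := ih _ hlt₂ U₂ (S₂ ∪ X) hsub₂ (by omega) (by omega) rfl
  have hX₁ : X ⊆ R₁ := Finset.subset_union_right.trans hR₁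
  have hX₂ : X ⊆ R₂ := Finset.subset_union_right.trans hR₂
  have hglue := h₁.glue h₂ (hUX ▸ hX₁) (hUX ▸ hX₂) (by
    intro u hu v hv huv
    by_cases huQ : u ∈ Q
    · right
      obtain ⟨y, hy₁, hy₂⟩ := hB.edge_mem huv
      have hvU := ((hU₂Q v).1 hv).1
      have := hQ₂ y u (Finset.mem_inter.2 ⟨hy₁, ((hU₁Q u).1 hu).1⟩) huQ v
        (Finset.mem_inter.2 ⟨hy₂, hvU⟩)
      exact (hU₁Q v).2 ⟨hvU, this⟩
    · left
      exact (hU₂Q u).2 ⟨((hU₁Q u).1 hu).1, huQ⟩)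
  rw [hU] at hglue
  refine ⟨_, _, hglue, ?_, ?_, ?_⟩
  · intro v hv
    have h1 := @hR₁ v
    have h2 := @hR₂ v
    rw [Finset.mem_union, hS₁Q] at h1
    rw [Finset.mem_union, hS₂Q] at h2
    rw [Finset.mem_union]
    tauto
  · have := Finset.card_union_add_card_inter R₁ R₂
    have := Finset.card_le_card (Finset.subset_inter hX₁ hX₂)
    omega
  · have : 2 * k * (c₁ + c₂ + 1) + 2 * k = 2 * k * (c₁ + 1) + 2 * k * (c₂ + 1) := by ring
    omega

lemma exists_isTreeDecomp_of_treewidth_le {V : Type} [Fintype V] {G : SimpleGraph V} {m : ℕ}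
    (h : treewidth G ≤ m) :
    ∃ (ι : Type) (_ : Fintype ι) (T : SimpleGraph ι) (B : ι → Set V),
      IsTreeDecomp G T B ∧ ∀ x, (B x).ncard ≤ m + 1 := by
  have hne : {k | ∃ (ι : Type) (_ : Fintype ι) (T : SimpleGraph ι) (B : ι → Set V),
      IsTreeDecomp G T B ∧ ∀ x, (B x).ncard ≤ k + 1}.Nonempty := by
    refine ⟨Nat.card V, Unit, inferInstance, ⊥, fun _ => Set.univ, ⟨?_, ?_, ?_⟩, ?_⟩
    · exact SimpleGraph.IsTree.of_subsingleton
    · exact fun _ _ _ => ⟨(), trivial, trivial⟩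
    · intro v
      have : Nonempty {x : Unit | v ∈ (Set.univ : Set V)} := ⟨⟨(), trivial⟩⟩
      exact ⟨SimpleGraph.Preconnected.of_subsingleton⟩
    · intro x
      rw [Set.ncard_univ]
      omega
  obtain ⟨ι, hι, T, B, hB, hw⟩ := Nat.sInf_mem hne
  exact ⟨ι, hι, T, B, hB, fun x => (hw x).trans (Nat.add_le_add_right h 1)⟩

lemma ncard_neighborSet_le_maxDeg {V : Type*} [Fintype V] (G : SimpleGraph V) (v : V) :
    (G.neighborSet v).ncard ≤ maxDeg G :=
  le_csSup (Set.finite_range _).bddAbove ⟨v, rfl⟩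

/-- Fix positive integers `k` and `d`. Every graph `G` with
`tw(G) ≤ k − 1` and `Δ(G) ≤ d` has a tree-partition of width at most `18kd` over a tree
`T` with `Δ(T) ≤ 6d`. -/
theorem exists_treePartition_width_eighteen (k d : ℕ) (hk : 1 ≤ k) (hd : 1 ≤ d)
    {V : Type} [Fintype V] [Nonempty V] (G : SimpleGraph V)
    (htw : treewidth G ≤ k - 1) (hΔ : maxDeg G ≤ d) :
    ∃ (ι : Type) (_ : Fintype ι) (T : SimpleGraph ι) (B : ι → Set V),
      IsTreePartition G T B ∧
      (∀ x, (B x).ncard ≤ 18 * k * d) ∧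
      (∀ x, (T.neighborSet x).ncard ≤ 6 * d) := by

  classical
  obtain ⟨ι, _, T, B, hB, hw⟩ := exists_isTreeDecomp_of_treewidth_le htw
  have hdeg : 6 * d - 1 + 1 = 6 * d := by omega
  have hkd : k ≤ k * d := Nat.le_mul_of_pos_right k hd
  have hassoc₁ : 18 * k * d = 18 * (k * d) := by ring
  have hassoc₂ : 12 * k * d = 12 * (k * d) := by ring
  by_cases hV : Fintype.card V ≤ 4 * k
  · have := (HasRootedPartition.single (G := G) (w := 18 * k * d) (e := 6 * d - 1)
      Finset.univ).exists_isTreePartition Finset.univ_nonempty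
      (by rw [Finset.card_univ]; omega) (Nat.zero_le _)
    rwa [hdeg] at this
  obtain ⟨S, -, hS⟩ := Finset.exists_subset_card_eq (s := (Finset.univ : Finset V)) (n := 4 * k)
    (by rw [Finset.card_univ]; omega)
  obtain ⟨R, c, h, hSR, hR, hc⟩ := hasRootedPartition_of_isTreeDecomp (G := G) (T := T)
    (B := fun x => (B x).toFinset) hk hd (by simpa using hB)
    (fun x => by
      rw [← Set.ncard_eq_toFinset_card']
      exact (hw x).trans (by omega))
    (fun v => ⟨(G.neighborSet v).toFinset, by
      rw [← Set.ncard_eq_toFinset_card']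
      exact (ncard_neighborSet_le_maxDeg G v).trans hΔ, fun u hu => by simpa using hu⟩)
    Finset.univ S (Finset.subset_univ _) hS.ge (by omega)
  have := h.exists_isTreePartition (Finset.card_pos.1 (by have := Finset.card_le_card hSR; omega))
    (by omega) (by
      have : 2 * k * (c + 1) ≤ 2 * k * 2 := hc.trans (by omega)
      have := Nat.le_of_mul_le_mul_left this (by omega)
      omega)
  rwa [hdeg] at this
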